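/- arXiv:1609.02812 — 7 statements merged into one kernel-verified Lean document; each statement's English description precedes it below -/
import Mathlib

section
/- Let K be a field with inverse totalized by 0⁻¹ = 0. For every c in K, the finite support sum ∑*_x x·(1 − (c − x)·(c − x)⁻¹) over all x in K equals c. -/
/-- In any field with totalized inverse (`0⁻¹ = 0`), for any `c`,
`∑*_x x · 0_{c - x} = c`, where `0_y = 1 - y · y⁻¹`. -/
theorem finsum_mul_zero_part_eq {K : Type*} [Field K] (c : K) :
    ∑ᶠ x : K, x * (1 - (c - x) * (c - x)⁻¹) = c := by
  rw [finsum_eq_single _ c]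
  · simp
  · intro x hx
    rw [mul_inv_cancel₀ (sub_ne_zero.mpr hx.symm), sub_self, mul_zero]
end

section
/- Define t : ℝ → ℝ → ℝ by t(x,y) = (1 − x·x⁻¹)·(1 − y·y⁻¹) + (1 − (1 − x)·(1 − x)⁻¹), with inverse on ℝ totalized by 0⁻¹ = 0. Then the two-dimensional finite support sum over all pairs (x,y) ∈ ℝ × ℝ of t(x,y) equals 0, while the iterated finite support sum ∑*_x ∑*_y t(x,y) equals 1. In particular, two-dimensional finite support summation cannot be reduced to a composition of two one-dimensional finite support summations. -/
/-- With `t(x,y) = 0_x · 0_y + 0_{1-x}` (where `0_z = 1 - z · z⁻¹` and `0⁻¹ = 0` in `ℝ`),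
the two-dimensional finite support sum of `t` is `0`, while the iterated
finite support sum `∑*_x ∑*_y t(x,y)` is `1`; in particular the two differ, so
two-dimensional FSS does not reduce to a composition of two one-dimensional FSS's. -/
theorem two_dim_fss_ne_iterated_fss
    (t : ℝ → ℝ → ℝ)
    (ht : ∀ x y : ℝ, t x y = (1 - x * x⁻¹) * (1 - y * y⁻¹) + (1 - (1 - x) * (1 - x)⁻¹)) :
    (∑ᶠ p : ℝ × ℝ, t p.1 p.2 = 0) ∧
    (∑ᶠ x : ℝ, ∑ᶠ y : ℝ, t x y = 1) ∧
    (∑ᶠ p : ℝ × ℝ, t p.1 p.2) ≠ (∑ᶠ x : ℝ, ∑ᶠ y : ℝ, t x y) := by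
  have h_one : ∀ y, t 1 y = 1 := fun y => by simp [ht]
  have h_two : ∑ᶠ p : ℝ × ℝ, t p.1 p.2 = 0 := by
    refine finsum_of_infinite_support fun hfin => ?_
    have hinj : Function.Injective (fun y : ℝ => ((1 : ℝ), y)) := Prod.mk_right_injective 1
    have huniv : (fun y : ℝ => ((1 : ℝ), y)) ⁻¹'
        Function.support (fun p : ℝ × ℝ => t p.1 p.2) = Set.univ := by
      ext y
      simp [h_one]
    exact Set.infinite_univ (huniv ▸ hfin.preimage hinj.injOn)
  have h_iter : ∑ᶠ x : ℝ, ∑ᶠ y : ℝ, t x y = 1 := by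
    have h_zero : ∑ᶠ y : ℝ, t 0 y = 1 := by
      rw [finsum_eq_single _ (0 : ℝ) fun y hy => by simp [ht, hy]]
      simp [ht]
    rw [finsum_eq_single _ (0 : ℝ), h_zero]
    intro x hx
    obtain rfl | hx1 := eq_or_ne x 1
    · simp only [h_one]
      refine finsum_of_infinite_support ?_
      rw [Function.support_const one_ne_zero]
      exact Set.infinite_univ
    · have hx1' : 1 - x ≠ 0 := sub_ne_zero.mpr hx1.symm
      simp [ht, hx, hx1']
  refine ⟨h_two, h_iter, ?_⟩
  rw [h_two, h_iter]
  exact zero_ne_one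
end

section
/- Let E be a Boolean algebra and let P : E → ℝ be a probability function, i.e. P(⊤) = 1, P(⊥) = 0, P(x) = |P(x)| for all x, and P(x ∨ y) = P(x) + P(y) − P(x ∧ y) for all x, y. Then for all x, y in E: P(x ∧ y)·P(y)·P(y)⁻¹ = P(x ∧ y), where inverse on ℝ is totalized by 0⁻¹ = 0. -/
/-- A probability function on a Boolean algebra satisfies the weakened axiom
`P(x ∧ y) · P(y) · P(y)⁻¹ = P(x ∧ y)`, with inverse on `ℝ` totalized by `0⁻¹ = 0`. -/
theorem pf_implies_weak_axiom {E : Type*} [BooleanAlgebra E] (P : E → ℝ)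
    (htop : P ⊤ = 1) (hbot : P ⊥ = 0) (habs : ∀ x, P x = |P x|)
    (hincl : ∀ x y, P (x ⊔ y) = P x + P y - P (x ⊓ y)) :
    ∀ x y, P (x ⊓ y) * P y * (P y)⁻¹ = P (x ⊓ y) := by
  intro x y
  have h_nonneg : ∀ z, 0 ≤ P z := fun z => habs z ▸ abs_nonneg (P z)
  by_cases hy : P y = 0
  · have h_split := hincl (x ⊓ y) (xᶜ ⊓ y)
    have h_sup : x ⊓ y ⊔ xᶜ ⊓ y = y := by
      rw [← inf_sup_right, sup_compl_eq_top, top_inf_eq]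
    have h_inf : x ⊓ y ⊓ (xᶜ ⊓ y) = ⊥ := by
      rw [← inf_inf_distrib_right, inf_compl_eq_bot, bot_inf_eq]
    rw [h_sup, h_inf, hbot, hy] at h_split
    have h_zero : P (x ⊓ y) = 0 := by
      linarith [h_nonneg (x ⊓ y), h_nonneg (xᶜ ⊓ y)]
    simp [h_zero]
  · exact mul_inv_cancel_right₀ hy _
end

section
/- Let E be a Boolean algebra and let P : E → ℝ satisfy P(⊤) = 1, P(⊥) = 0, and P(x) = |P(x)| for all x. If Bayes' rule BR holds for all x, y in E, i.e. P(x ∧ y)·P(y)⁻¹ = (P(y ∧ x)·P(x)⁻¹·P(x))·P(y)⁻¹, then for all x, y in E: P(x ∧ y)·P(x)·P(x)⁻¹ = P(x ∧ y). In other words, BR implies the weakened probability axiom. -/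
/-- Bayes' rule BR implies the weakened probability axiom:
if `P(x ∧ y) · P(y)⁻¹ = (P(y ∧ x) · P(x)⁻¹ · P(x)) · P(y)⁻¹` for all `x, y`,
then `P(x ∧ y) · P(x) · P(x)⁻¹ = P(x ∧ y)` for all `x, y`. -/
theorem bayes_implies_weak_axiom {E : Type*} [BooleanAlgebra E] (P : E → ℝ)
    (htop : P ⊤ = 1) (hbot : P ⊥ = 0) (habs : ∀ x, P x = |P x|)
    (hBR : ∀ x y, P (x ⊓ y) * (P y)⁻¹ = (P (y ⊓ x) * (P x)⁻¹ * P x) * (P y)⁻¹) :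
    ∀ x y, P (x ⊓ y) * P x * (P x)⁻¹ = P (x ⊓ y) := by
  intro x y
  by_cases hx : P x = 0
  · have h := hBR x (x ⊓ y)
    rw [← inf_assoc, inf_idem, hx, mul_zero, zero_mul] at h
    have hxy : P (x ⊓ y) = 0 := by simpa using h
    simp [hxy]
  · exact mul_inv_cancel_right₀ hx _
end

section
/- Let E be a Boolean algebra and let P : E → ℝ satisfy the weakened axioms WPF: P(⊤) = 1, P(⊥) = 0, P(x) = |P(x)| for all x, and P(x ∧ y)·P(y)·P(y)⁻¹ = P(x ∧ y) for all x, y. If moreover the second form of Bayes' rule BR₂ holds for all x, y, z in E, i.e. P⁰(x | y) = P⁰(y | x)·P(x)·(P⁰(y | z)·P(z) + P⁰(y | ¬z)·P(¬z))⁻¹, then the law of total probability holds: for all y, z in E, P(y) = P(y ∧ z) + P(y ∧ ¬z). -/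
/-- WPF together with the second form of Bayes' rule BR₂ implies the law of total
probability: `P(y) = P(y ∧ z) + P(y ∧ ¬z)`. Here
`P⁰(x|y) = P(x ∧ y) · P(y)⁻¹` with inverse on `ℝ` totalized by `0⁻¹ = 0`. -/
theorem wpf_br2_implies_total_probability {E : Type*} [BooleanAlgebra E] (P : E → ℝ)
    (htop : P ⊤ = 1) (hbot : P ⊥ = 0) (habs : ∀ x, P x = |P x|)
    (hweak : ∀ x y, P (x ⊓ y) * P y * (P y)⁻¹ = P (x ⊓ y))
    (hBR2 : ∀ x y z, P (x ⊓ y) * (P y)⁻¹ =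
      P (y ⊓ x) * (P x)⁻¹ * P x *
        (P (y ⊓ z) * (P z)⁻¹ * P z + P (y ⊓ zᶜ) * (P zᶜ)⁻¹ * P zᶜ)⁻¹) :
    ∀ y z, P y = P (y ⊓ z) + P (y ⊓ zᶜ) := by
  have cancel : ∀ a b, P (a ⊓ b) * (P b)⁻¹ * P b = P (a ⊓ b) := fun a b => by
    rw [mul_right_comm, hweak]
  intro y z
  by_cases hy : P y = 0
  · have null : ∀ w, P (y ⊓ w) = 0 := fun w => by
      rw [inf_comm, ← hweak, hy, mul_zero, zero_mul]
    rw [hy, null, null, add_zero]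
  · have h := hBR2 y y z
    rw [cancel, cancel, cancel, inf_idem, mul_inv_cancel₀ hy] at h
    exact eq_of_div_eq_one (by rw [div_eq_mul_inv, ← h])
end

section
/- Let E be a Boolean algebra and let P : E → ℝ satisfy the law of total probability: for all y, z in E, P(y) = P(y ∧ z) + P(y ∧ ¬z). Then the inclusion–exclusion axiom holds: for all x, y in E, P(x ∨ y) = P(x) + P(y) − P(x ∧ y). -/
/-- The law of total probability implies the inclusion–exclusion axiom:
if `P(y) = P(y ∧ z) + P(y ∧ ¬z)` for all `y, z`, then
`P(x ∨ y) = P(x) + P(y) − P(x ∧ y)` for all `x, y`. -/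
theorem total_probability_implies_inclusion_exclusion
    {E : Type*} [BooleanAlgebra E] (P : E → ℝ)
    (htotal : ∀ y z, P y = P (y ⊓ z) + P (y ⊓ zᶜ)) :
    ∀ x y, P (x ⊔ y) = P x + P y - P (x ⊓ y) := by
  intro x y
  have hxy := htotal (x ⊔ y) x
  rw [inf_comm, inf_sup_self, inf_sup_right, inf_compl_self, bot_sup_eq] at hxy
  have hy := htotal y x
  rw [inf_comm y x] at hy
  linarith
end

section
/- Let E be a Boolean algebra, P : E → ℝ a probability function (P(⊤) = 1, P(⊥) = 0, P(x) = |P(x)| for all x, and P(x ∨ y) = P(x) + P(y) − P(x ∧ y) for all x, y), n a natural number, e₁, …, eₙ pairwise nonoverlapping events (eᵢ ∧ eⱼ = ⊥ for i ≠ j), and y₁, …, yₙ and z₁, …, zₙ real numbers. Define the extracted joint probability mass function G : ℝ × ℝ → ℝ by G(x,w) = Σᵢ₌₁ⁿ (if yᵢ = x and zᵢ = w then P(eᵢ) else 0). Then the covariance computed from G equals the covariance of the pair of event-sharing conditional values: ∑*_{(x,w)} x·w·G(x,w) − (∑*_x x·(∑*_w G(x,w)))·(∑*_w w·(∑*_x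 G(x,w))) = Σᵢ₌₁ⁿ yᵢ·zᵢ·P(eᵢ) − (Σᵢ₌₁ⁿ yᵢ·P(eᵢ))·(Σᵢ₌₁ⁿ zᵢ·P(eᵢ)). -/
/-- Integrating `f` against a finite combination of point masses. -/
theorem finsum_mul_sum_ite_eq {ι α R : Type*} [Fintype ι] [DecidableEq α]
    [NonUnitalNonAssocSemiring R] (u : ι → α) (c : ι → R) (f : α → R) :
    ∑ᶠ a, f a * ∑ i, (if u i = a then c i else 0) = ∑ i, f (u i) * c i := by
  simp only [Finset.mul_sum]
  rw [finsum_sum_comm]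
  · refine Finset.sum_congr rfl fun i _ => ?_
    rw [finsum_eq_single _ (u i) fun a ha => by simp [ha.symm]]
    simp
  · intro i _
    refine (Set.finite_singleton (u i)).subset fun a ha => ?_
    by_contra h
    exact ha (by simp [Ne.symm h])

/-- The total mass of a finite combination of point masses. -/
theorem finsum_sum_ite_eq {ι α R : Type*} [Fintype ι] [DecidableEq α]
    [NonAssocSemiring R] (u : ι → α) (c : ι → R) :
    ∑ᶠ a, ∑ i, (if u i = a then c i else 0) = ∑ i, c i := by
  simpa using finsum_mul_sum_ite_eq u c fun _ => 1


/-- Covariance via joint PMF extraction: for event-sharing nonoverlapping flat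
conditional values `X = Σᵢ eᵢ :→ v(yᵢ)` and `Y = Σᵢ eᵢ :→ v(zᵢ)` with extracted
joint PMF `G(x,w) = Σᵢ 0_{yᵢ−x} · 0_{zᵢ−w} · P(eᵢ)`, the covariance computed
from `G` (via its marginalisations) agrees with
`COV_P(X,Y) = Σᵢ yᵢ zᵢ P(eᵢ) − (Σᵢ yᵢ P(eᵢ)) · (Σᵢ zᵢ P(eᵢ))`. -/
theorem covariance_via_joint_pmf_extraction {E : Type*} [BooleanAlgebra E] (P : E → ℝ)
    (htop : P ⊤ = 1) (hbot : P ⊥ = 0) (habs : ∀ x, P x = |P x|)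
    (hincl : ∀ x y, P (x ⊔ y) = P x + P y - P (x ⊓ y))
    (n : ℕ) (e : Fin n → E) (hdisj : ∀ i j, i ≠ j → e i ⊓ e j = ⊥)
    (y z : Fin n → ℝ) (G : ℝ × ℝ → ℝ)
    (hG : ∀ x w, G (x, w) = ∑ i, if y i = x ∧ z i = w then P (e i) else 0) :
    (∑ᶠ p : ℝ × ℝ, p.1 * p.2 * G p) -
        (∑ᶠ x : ℝ, x * ∑ᶠ w : ℝ, G (x, w)) * (∑ᶠ w : ℝ, w * ∑ᶠ x : ℝ, G (x, w)) =
      (∑ i, y i * z i * P (e i)) -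
        (∑ i, y i * P (e i)) * (∑ i, z i * P (e i)) := by
  have hjoint : ∀ p, G p = ∑ i, if (y i, z i) = p then P (e i) else 0 := fun ⟨x, w⟩ => by
    simp only [hG, Prod.mk.injEq]
  have hfst : ∀ x, ∑ᶠ w, G (x, w) = ∑ i, if y i = x then P (e i) else 0 := fun x => by
    rw [← finsum_sum_ite_eq z]
    simp only [hG, and_comm (a := y _ = x), ite_and]
  have hsnd : ∀ w, ∑ᶠ x, G (x, w) = ∑ i, if z i = w then P (e i) else 0 := fun w => by
    rw [← finsum_sum_ite_eq y]
    simp only [hG, ite_and]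
  simp only [hfst, hsnd]
  rw [finsum_mul_sum_ite_eq y _ fun x => x, finsum_mul_sum_ite_eq z _ fun w => w]
  simp only [hjoint]
  rw [finsum_mul_sum_ite_eq (fun i => (y i, z i)) _ fun p => p.1 * p.2]
end
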